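/- Bottleneck stability of the semiring generated by the tropical rational coordinates: let 𝒢 be the smallest set of functions from barcodes to ℝ containing all constant functions and the functions E_{m,k,l,p} for all positive integers m and all nonnegative integers k, l, p with k + l + p ≥ 1, and closed under pointwise addition, pointwise maximum and pointwise minimum. Then for every F ∈ 𝒢 there exists a constant C ≥ 0 such that |F(B_1) − F(B_2)| ≤ C · d_∞(B_1, B_2) for every pair of barcodes B_1 and B_2. -/

import Mathlib

/-- Distance between two intervals given as (left endpoint, length):
`d_∞((x₁,d₁),(x₂,d₂)) = max(|x₁ − x₂|, |d₁ − d₂ + x₁ − x₂|)`. -/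
def intervalDist (I J : ℝ × ℝ) : ℝ := max |I.1 - J.1| |I.2 - J.2 + I.1 - J.1|

/-- A partial matching between two barcodes (finite multisets of intervals), encoded
as a multiset of matched pairs: the first components form a submultiset of `B₁`, the
second components a submultiset of `B₂`. -/
def IsMatching (B₁ B₂ : Multiset (ℝ × ℝ)) (M : Multiset ((ℝ × ℝ) × (ℝ × ℝ))) : Prop :=
  M.map Prod.fst ≤ B₁ ∧ M.map Prod.snd ≤ B₂

/-- The bottleneck penalty `P_∞(θ)` of a partial matching: the maximum of the interval
distances of matched pairs and of `d/2` over all unmatched intervals `(x, d)`. -/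
noncomputable def penaltyInf (B₁ B₂ : Multiset (ℝ × ℝ))
    (M : Multiset ((ℝ × ℝ) × (ℝ × ℝ))) : ℝ :=
  ((M.map fun IJ : (ℝ × ℝ) × (ℝ × ℝ) => intervalDist IJ.1 IJ.2) +
      (((B₁ - M.map Prod.fst) + (B₂ - M.map Prod.snd)).map
        fun I : ℝ × ℝ => I.2 / 2)).fold max 0

/-- The bottleneck distance between two barcodes. -/
noncomputable def bottleneckDist (B₁ B₂ : Multiset (ℝ × ℝ)) : ℝ :=
  sInf { r | ∃ M, IsMatching B₁ B₂ M ∧ r = penaltyInf B₁ B₂ M }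

/-- The `q`-th Wasserstein penalty `P_q(θ)` of a partial matching. -/
noncomputable def penaltyP (q : ℝ) (B₁ B₂ : Multiset (ℝ × ℝ))
    (M : Multiset ((ℝ × ℝ) × (ℝ × ℝ))) : ℝ :=
  (M.map fun IJ : (ℝ × ℝ) × (ℝ × ℝ) => intervalDist IJ.1 IJ.2 ^ q).sum +
    ((((B₁ - M.map Prod.fst) + (B₂ - M.map Prod.snd)).map
      fun I : ℝ × ℝ => (I.2 / 2) ^ q)).sum

/-- The `q`-th Wasserstein distance between two barcodes. -/
noncomputable def wassersteinDist (q : ℝ) (B₁ B₂ : Multiset (ℝ × ℝ)) : ℝ :=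
  (sInf { r | ∃ M, IsMatching B₁ B₂ M ∧ r = penaltyP q B₁ B₂ M }) ^ (1 / q)

/-- `sigmaN n B` = `σ_{(0,1)ⁿ}(B)`: the sum of the `n` largest lengths of intervals
of `B` (for barcodes, i.e. multisets of pairs of nonnegative reals, the supremum below
is exactly the sum of the `n` largest lengths, counting missing intervals as 0). -/
noncomputable def sigmaN (n : ℕ) (B : Multiset (ℝ × ℝ)) : ℝ :=
  sSup { r | ∃ s : Multiset ℝ, s ≤ B.map Prod.snd ∧ s.card ≤ n ∧ r = s.sum }

/-- The tropical rational coordinate `E_{m,k,l,p}` on barcodes: pad the barcode `B`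
with zero intervals `(0,0)` so that it has at least `k + l + p` intervals, and take the
maximum, over all choices of `p + k + l` pairwise distinct intervals
`(x_1, d_1), …, (x_{p+k+l}, d_{p+k+l})` of the padded barcode, of
`Σ_{i=1}^{p} (min(x_i, m·d_i) + d_i) + Σ_{i=p+1}^{p+k} min(x_i, m·d_i)
  + Σ_{i=p+k+1}^{p+k+l} d_i`. -/
noncomputable def Efun (m k l p : ℕ) (B : Multiset (ℝ × ℝ)) : ℝ :=
  sSup { r | ∃ S₁ S₂ S₃ : Multiset (ℝ × ℝ),
    S₁.card = p ∧ S₂.card = k ∧ S₃.card = l ∧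
    S₁ + S₂ + S₃ ≤ B + Multiset.replicate (p + k + l) ((0 : ℝ), (0 : ℝ)) ∧
    r = (S₁.map fun I : ℝ × ℝ => min I.1 ((m : ℝ) * I.2) + I.2).sum +
        (S₂.map fun I : ℝ × ℝ => min I.1 ((m : ℝ) * I.2)).sum +
        (S₃.map fun I : ℝ × ℝ => I.2).sum }

/-- A barcode: a finite multiset of intervals `(x, d) ∈ [0,∞) × [0,∞)`. -/
def Barcode : Type := { B : Multiset (ℝ × ℝ) // ∀ I ∈ B, 0 ≤ I.1 ∧ 0 ≤ I.2 }

/-- The smallest set of functions from barcodes to `ℝ` containing all constant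
functions and the functions `E_{m,k,l,p}` for all positive integers `m` and all
nonnegative integers `k, l, p` with `k + l + p ≥ 1`, and closed under pointwise
addition, pointwise maximum and pointwise minimum. -/
inductive MemG : (Barcode → ℝ) → Prop
  | const (c : ℝ) : MemG (fun _ => c)
  | coord (m k l p : ℕ) (hm : 1 ≤ m) (hklp : 1 ≤ k + l + p) :
      MemG (fun B => Efun m k l p B.1)
  | add {f g} : MemG f → MemG g → MemG (fun B => f B + g B)
  | max {f g} : MemG f → MemG g → MemG (fun B => max (f B) (g B))
  | min {f g} : MemG f → MemG g → MemG (fun B => min (f B) (g B))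

theorem Multiset.exists_le_map_eq_of_le_map {α β : Type*} {f : α → β} {s : Multiset β}
    {t : Multiset α} (h : s ≤ t.map f) : ∃ u ≤ t, u.map f = s := by
  obtain ⟨v, hv⟩ := Multiset.le_iff_exists_add.1 h
  obtain ⟨a, b, ha, -, rfl⟩ :=
    Multiset.rel_add_right.1 (Multiset.rel_map_left.1 (Multiset.rel_eq.2 hv))
  exact ⟨a, Multiset.le_add_right a b, Multiset.rel_eq.1 (Multiset.rel_map_left.2 ha)⟩

theorem Multiset.sum_map_le_of_rel {α β : Type*} {r : α → β → Prop} {f : α → ℝ} {g : β → ℝ}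
    {c : ℝ} (hfg : ∀ a b, r a b → f a ≤ g b + c) {s : Multiset α} {t : Multiset β}
    (h : Multiset.Rel r s t) : (s.map f).sum ≤ (t.map g).sum + s.card * c := by
  induction h with
  | zero => simp
  | cons hab _ ih =>
    simp only [Multiset.map_cons, Multiset.sum_cons, Multiset.card_cons, Nat.cast_add,
      Nat.cast_one]
    linarith [hfg _ _ hab]

theorem Multiset.le_fold_max {s : Multiset ℝ} {b x : ℝ} (hx : x ∈ s) : x ≤ s.fold max b := by
  induction s using Multiset.induction_on with
  | empty => simp at hx
  | cons a s ih =>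
    rw [Multiset.fold_cons_left]
    rcases Multiset.mem_cons.1 hx with rfl | h
    · exact le_max_left _ _
    · exact (ih h).trans (le_max_right _ _)

theorem Multiset.init_le_fold_max (s : Multiset ℝ) (b : ℝ) : b ≤ s.fold max b := by
  induction s using Multiset.induction_on with
  | empty => simp
  | cons a s ih =>
    rw [Multiset.fold_cons_left]
    exact ih.trans (le_max_right _ _)

/-- The weights `min x (m * d)` and `d` of `I` exceed those of `J` by at most `2 * m * ε` and
`2 * ε` respectively. -/
def WeightsLE (m : ℕ) (ε : ℝ) (I J : ℝ × ℝ) : Prop :=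
  min I.1 (m * I.2) ≤ min J.1 (m * J.2) + 2 * m * ε ∧ I.2 ≤ J.2 + 2 * ε

theorem weightsLE_of_intervalDist_le {m : ℕ} (hm : 1 ≤ m) {ε : ℝ} {I J : ℝ × ℝ}
    (h : intervalDist I J ≤ ε) : WeightsLE m ε I J := by
  have hm' : (1 : ℝ) ≤ m := by exact_mod_cast hm
  obtain ⟨h₁, h₂⟩ := max_le_iff.1 h
  have hε : 0 ≤ ε := (abs_nonneg _).trans h₁
  rw [abs_le] at h₁ h₂
  have hd : I.2 ≤ J.2 + 2 * ε := by linarith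
  refine ⟨?_, hd⟩
  rw [← min_add_add_right]
  refine min_le_min ?_ ?_
  · nlinarith
  · nlinarith

theorem weightsLE_zero {m : ℕ} {ε : ℝ} {I : ℝ × ℝ} (h : I.2 / 2 ≤ ε) :
    WeightsLE m ε I (0, 0) := by
  have hm' : (0 : ℝ) ≤ m := m.cast_nonneg
  refine ⟨(min_le_right _ _).trans ?_, ?_⟩
  · simp only [mul_zero, min_self]
    nlinarith
  · simp only
    linarith

theorem exists_rel_weightsLE {m : ℕ} (hm : 1 ≤ m) {ε : ℝ} (hε : 0 ≤ ε)
    {B₁ B₂ : Multiset (ℝ × ℝ)} {M : Multiset ((ℝ × ℝ) × (ℝ × ℝ))} (hM : IsMatching B₁ B₂ M)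
    (hpair : ∀ P ∈ M, intervalDist P.1 P.2 ≤ ε)
    (hrest : ∀ I ∈ B₁ - M.map Prod.fst, I.2 / 2 ≤ ε) {n : ℕ} {S : Multiset (ℝ × ℝ)}
    (hcard : S.card = n) (hS : S ≤ B₁ + Multiset.replicate n (0, 0)) :
    ∃ T ≤ B₂ + Multiset.replicate n (0, 0), Multiset.Rel (WeightsLE m ε) S T := by
  obtain ⟨Q, hQM, hQ⟩ := Multiset.exists_le_map_eq_of_le_map
    (show S ∩ M.map Prod.fst ≤ M.map Prod.fst from Multiset.inter_le_right)
  have hunmatched : S - M.map Prod.fst ≤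
      (B₁ - M.map Prod.fst) + Multiset.replicate n (0, 0) := by
    rw [tsub_le_iff_left, ← add_assoc, add_tsub_cancel_of_le hM.1]
    exact hS
  refine ⟨Multiset.replicate (S - M.map Prod.fst).card (0, 0) + Q.map Prod.snd, ?_, ?_⟩
  · rw [add_comm B₂]
    refine add_le_add ?_ ((Multiset.map_le_map hQM).trans hM.2)
    refine Multiset.replicate_mono _ ?_
    rw [← hcard]
    exact Multiset.card_le_card tsub_le_self
  · suffices Multiset.Rel (WeightsLE m ε) (S - M.map Prod.fst + Q.map Prod.fst)
        (Multiset.replicate (S - M.map Prod.fst).card (0, 0) + Q.map Prod.snd) by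
      rwa [hQ, Multiset.sub_add_inter] at this
    refine Multiset.Rel.add (Multiset.rel_replicate_right.2 ⟨rfl, fun I hI => ?_⟩) ?_
    · apply weightsLE_zero
      rcases Multiset.mem_add.1 (Multiset.mem_of_le hunmatched hI) with h | h
      · exact hrest I h
      · simpa [Multiset.eq_of_mem_replicate h] using hε
    · exact Multiset.rel_map.2 (Multiset.rel_refl_of_refl_on fun P hP =>
        weightsLE_of_intervalDist_le hm (hpair P (Multiset.mem_of_le hQM hP)))

/-- The values over which `Efun` takes its supremum. -/
def coordValues (m k l p : ℕ) (B : Multiset (ℝ × ℝ)) : Set ℝ :=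
  { r | ∃ S₁ S₂ S₃ : Multiset (ℝ × ℝ),
    S₁.card = p ∧ S₂.card = k ∧ S₃.card = l ∧
    S₁ + S₂ + S₃ ≤ B + Multiset.replicate (p + k + l) ((0 : ℝ), (0 : ℝ)) ∧
    r = (S₁.map fun I : ℝ × ℝ => min I.1 ((m : ℝ) * I.2) + I.2).sum +
        (S₂.map fun I : ℝ × ℝ => min I.1 ((m : ℝ) * I.2)).sum +
        (S₃.map fun I : ℝ × ℝ => I.2).sum }

theorem coordValues_nonempty (m k l p : ℕ) (B : Multiset (ℝ × ℝ)) :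
    (coordValues m k l p B).Nonempty := by
  refine ⟨_, Multiset.replicate p (0, 0), Multiset.replicate k (0, 0),
    Multiset.replicate l (0, 0), Multiset.card_replicate _ _, Multiset.card_replicate _ _,
    Multiset.card_replicate _ _, ?_, rfl⟩
  rw [← Multiset.replicate_add, ← Multiset.replicate_add]
  exact Multiset.le_add_left _ _

theorem exists_coordValues_le {m : ℕ} (hm : 1 ≤ m) (k l p : ℕ) {ε : ℝ} (hε : 0 ≤ ε)
    {B₁ B₂ : Multiset (ℝ × ℝ)} {M : Multiset ((ℝ × ℝ) × (ℝ × ℝ))} (hM : IsMatching B₁ B₂ M)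
    (hpair : ∀ P ∈ M, intervalDist P.1 P.2 ≤ ε)
    (hrest : ∀ I ∈ B₁ - M.map Prod.fst, I.2 / 2 ≤ ε) {r : ℝ} (hr : r ∈ coordValues m k l p B₁) :
    ∃ r' ∈ coordValues m k l p B₂, r ≤ r' + (p + k + l) * (2 * m + 2) * ε := by
  obtain ⟨S₁, S₂, S₃, h₁, h₂, h₃, hS, rfl⟩ := hr
  obtain ⟨T, hT, hrel⟩ := exists_rel_weightsLE hm hε hM hpair hrest
    (by simp [h₁, h₂, h₃]) hS
  obtain ⟨T₁₂, T₃, hrel₁₂, hrel₃, rfl⟩ := Multiset.rel_add_left.1 hrel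
  obtain ⟨T₁, T₂, hrel₁, hrel₂, rfl⟩ := Multiset.rel_add_left.1 hrel₁₂
  refine ⟨_, ⟨T₁, T₂, T₃, (Multiset.card_eq_card_of_rel hrel₁).symm.trans h₁,
    (Multiset.card_eq_card_of_rel hrel₂).symm.trans h₂,
    (Multiset.card_eq_card_of_rel hrel₃).symm.trans h₃, hT, rfl⟩, ?_⟩
  have hmε : 0 ≤ m * ε := mul_nonneg m.cast_nonneg hε
  have b₁ := Multiset.sum_map_le_of_rel (c := (2 * m + 2) * ε)
    (f := fun I : ℝ × ℝ => min I.1 ((m : ℝ) * I.2) + I.2)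
    (g := fun I : ℝ × ℝ => min I.1 ((m : ℝ) * I.2) + I.2)
    (fun I J h => by linarith [h.1, h.2]) hrel₁
  have b₂ := Multiset.sum_map_le_of_rel (c := (2 * m + 2) * ε)
    (f := fun I : ℝ × ℝ => min I.1 ((m : ℝ) * I.2))
    (g := fun I : ℝ × ℝ => min I.1 ((m : ℝ) * I.2))
    (fun I J h => by linarith [h.1]) hrel₂
  have b₃ := Multiset.sum_map_le_of_rel (c := (2 * m + 2) * ε)
    (f := fun I : ℝ × ℝ => I.2) (g := fun I : ℝ × ℝ => I.2)
    (fun I J h => by linarith [h.2]) hrel₃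
  rw [h₁] at b₁
  rw [h₂] at b₂
  rw [h₃] at b₃
  linarith

theorem penaltyInf_nonneg (B₁ B₂ : Multiset (ℝ × ℝ)) (M : Multiset ((ℝ × ℝ) × (ℝ × ℝ))) :
    0 ≤ penaltyInf B₁ B₂ M :=
  Multiset.init_le_fold_max _ _

theorem intervalDist_le_penaltyInf {B₁ B₂ : Multiset (ℝ × ℝ)}
    {M : Multiset ((ℝ × ℝ) × (ℝ × ℝ))} {P : (ℝ × ℝ) × (ℝ × ℝ)} (hP : P ∈ M) :
    intervalDist P.1 P.2 ≤ penaltyInf B₁ B₂ M :=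
  Multiset.le_fold_max (Multiset.mem_add.2 (Or.inl (Multiset.mem_map_of_mem _ hP)))

theorem half_le_penaltyInf {B₁ B₂ : Multiset (ℝ × ℝ)} {M : Multiset ((ℝ × ℝ) × (ℝ × ℝ))}
    {I : ℝ × ℝ} (hI : I ∈ B₁ - M.map Prod.fst) : I.2 / 2 ≤ penaltyInf B₁ B₂ M :=
  Multiset.le_fold_max (Multiset.mem_add.2 (Or.inr
    (Multiset.mem_map_of_mem (fun I : ℝ × ℝ => I.2 / 2) (Multiset.mem_add.2 (Or.inl hI)))))

theorem intervalDist_comm (I J : ℝ × ℝ) : intervalDist I J = intervalDist J I := by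
  unfold intervalDist
  rw [abs_sub_comm I.1, ← abs_neg (I.2 - J.2 + I.1 - J.1)]
  ring_nf

theorem IsMatching.swap {B₁ B₂ : Multiset (ℝ × ℝ)} {M : Multiset ((ℝ × ℝ) × (ℝ × ℝ))}
    (hM : IsMatching B₁ B₂ M) : IsMatching B₂ B₁ (M.map Prod.swap) := by
  simpa [IsMatching, Multiset.map_map, Function.comp_def] using And.intro hM.2 hM.1

theorem penaltyInf_swap (B₁ B₂ : Multiset (ℝ × ℝ)) (M : Multiset ((ℝ × ℝ) × (ℝ × ℝ))) :
    penaltyInf B₂ B₁ (M.map Prod.swap) = penaltyInf B₁ B₂ M := by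
  simp only [penaltyInf, Multiset.map_map, Function.comp_def, Prod.fst_swap, Prod.snd_swap]
  rw [add_comm (B₂ - _)]
  simp_rw [intervalDist_comm]

theorem coordValues_bddAbove {m : ℕ} (hm : 1 ≤ m) (k l p : ℕ) (B : Multiset (ℝ × ℝ)) :
    BddAbove (coordValues m k l p B) := by
  refine ⟨0 + (p + k + l) * (2 * m + 2) * penaltyInf B 0 0, fun r hr => ?_⟩
  obtain ⟨r', ⟨S₁, S₂, S₃, -, -, -, hS, rfl⟩, h⟩ :=
    exists_coordValues_le (B₂ := 0) (M := 0) hm k l p (penaltyInf_nonneg B 0 0)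
      (by simp [IsMatching]) (by simp) (fun I hI => half_le_penaltyInf hI) hr
  have hz : ∀ I ∈ S₁ + S₂ + S₃, I = (0, 0) := fun I hI =>
    Multiset.eq_of_mem_replicate (by simpa using Multiset.mem_of_le hS hI)
  rw [Multiset.sum_eq_zero (s := S₁.map _), Multiset.sum_eq_zero (s := S₂.map _),
    Multiset.sum_eq_zero (s := S₃.map _), add_zero, add_zero] at h
  · exact h
  all_goals
    intro x hx
    obtain ⟨I, hI, rfl⟩ := Multiset.mem_map.1 hx
    simp [hz I (by simp [hI])]

theorem Efun_le_add_penaltyInf {m : ℕ} (hm : 1 ≤ m) (k l p : ℕ) {B₁ B₂ : Multiset (ℝ × ℝ)}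
    {M : Multiset ((ℝ × ℝ) × (ℝ × ℝ))} (hM : IsMatching B₁ B₂ M) :
    Efun m k l p B₁ ≤ Efun m k l p B₂ + (p + k + l) * (2 * m + 2) * penaltyInf B₁ B₂ M := by
  refine csSup_le (coordValues_nonempty m k l p B₁) fun r hr => ?_
  obtain ⟨r', hr', h⟩ := exists_coordValues_le hm k l p (penaltyInf_nonneg B₁ B₂ M) hM
    (fun P hP => intervalDist_le_penaltyInf hP) (fun I hI => half_le_penaltyInf hI) hr
  have : r' ≤ Efun m k l p B₂ := le_csSup (coordValues_bddAbove hm k l p B₂) hr'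
  linarith

theorem abs_Efun_sub_le {m k l p : ℕ} (hm : 1 ≤ m) (hklp : 1 ≤ k + l + p)
    (B₁ B₂ : Multiset (ℝ × ℝ)) :
    |Efun m k l p B₁ - Efun m k l p B₂| ≤
      (p + k + l) * (2 * m + 2) * bottleneckDist B₁ B₂ := by
  have hn : (1 : ℝ) ≤ k + l + p := by exact_mod_cast hklp
  have hC : (0 : ℝ) < (p + k + l) * (2 * m + 2) := mul_pos (by linarith) (by positivity)
  rw [← div_le_iff₀' hC]
  refine le_csInf ⟨_, 0, by simp [IsMatching], rfl⟩ ?_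
  rintro _ ⟨M, hM, rfl⟩
  rw [div_le_iff₀' hC, abs_sub_le_iff]
  have h₁ := Efun_le_add_penaltyInf hm k l p hM
  have h₂ := Efun_le_add_penaltyInf hm k l p hM.swap
  rw [penaltyInf_swap] at h₂
  constructor <;> linarith

theorem bottleneckDist_nonneg (B₁ B₂ : Multiset (ℝ × ℝ)) : 0 ≤ bottleneckDist B₁ B₂ := by
  refine Real.sInf_nonneg ?_
  rintro _ ⟨M, -, rfl⟩
  exact penaltyInf_nonneg B₁ B₂ M

/-- Bottleneck stability of the semiring generated by the tropical rational
coordinates. -/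
theorem tropical_coordinates_bottleneck_stability (F : Barcode → ℝ) (hF : MemG F) :
    ∃ C : ℝ, 0 ≤ C ∧ ∀ B₁ B₂ : Barcode,
      |F B₁ - F B₂| ≤ C * bottleneckDist B₁.1 B₂.1 := by
  induction hF with
  | const c => exact ⟨0, le_rfl, by simp⟩
  | coord m k l p hm hklp =>
    exact ⟨(p + k + l) * (2 * m + 2), by positivity, fun B₁ B₂ => abs_Efun_sub_le hm hklp _ _⟩
  | @add f g _ _ hf hg =>
    obtain ⟨C, hC, hf⟩ := hf
    obtain ⟨D, hD, hg⟩ := hg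
    refine ⟨C + D, add_nonneg hC hD, fun B₁ B₂ => ?_⟩
    rw [add_sub_add_comm, add_mul]
    exact (abs_add_le _ _).trans (add_le_add (hf B₁ B₂) (hg B₁ B₂))
  | @max f g _ _ hf hg =>
    obtain ⟨C, hC, hf⟩ := hf
    obtain ⟨D, hD, hg⟩ := hg
    refine ⟨max C D, hC.trans (le_max_left _ _), fun B₁ B₂ => ?_⟩
    rw [max_mul_of_nonneg _ _ (bottleneckDist_nonneg _ _)]
    exact (abs_max_sub_max_le_max _ _ _ _).trans (max_le_max (hf B₁ B₂) (hg B₁ B₂))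
  | @min f g _ _ hf hg =>
    obtain ⟨C, hC, hf⟩ := hf
    obtain ⟨D, hD, hg⟩ := hg
    refine ⟨max C D, hC.trans (le_max_left _ _), fun B₁ B₂ => ?_⟩
    rw [max_mul_of_nonneg _ _ (bottleneckDist_nonneg _ _)]
    exact (abs_min_sub_min_le_max _ _ _ _).trans (max_le_max (hf B₁ B₂) (hg B₁ B₂))
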